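/- Let Λ̃ = (λ̃_ℓ)_{ℓ≥0} be a nonnegative sequence in ℓ¹ that can be written as Λ̃ = μ̃∗μ̃ + ν̃∗ν̃ for nonnegative ℓ¹ sequences μ̃, ν̃ (convolution with respect to Gegenbauer linearization coefficients). Then the n-th optimal quadrature error of the RKHS H_{Λ̃} on S^d with kernel K_{Λ̃}(x,y) = Σ_ℓ λ̃_ℓ G_ℓ(x·y) satisfies e_n(H_{Λ̃})² ≥ λ̃₀ (1 − n λ̃₀ / Σ_ℓ λ̃_ℓ). -/

import Mathlib

open MeasureTheory RealInnerProductSpace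

/-- Normalized Gegenbauer polynomials `G_ℓ` of index `(d−1)/2` with `G_ℓ(1) = 1`,
defined by the three-term recurrence
`G_{m+1}(t) = ((2m+d−1) t G_m(t) − m G_{m−1}(t))/(m+d−1)`. -/
noncomputable def Geg (d : ℕ) : ℕ → ℝ → ℝ
  | 0 => fun _ => 1
  | 1 => fun t => t
  | n + 2 => fun t =>
      ((2 * (n : ℝ) + 1 + d) * t * Geg d (n + 1) t - ((n : ℝ) + 1) * Geg d n t) / ((n : ℝ) + d)

/-- Normalized integral against the Gegenbauer weight `w₀(t) = c₀(1−t²)^{(d−2)/2}` on `[−1,1]`. -/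
noncomputable def gInt (d : ℕ) (f : ℝ → ℝ) : ℝ :=
  (∫ t in Set.Icc (-1 : ℝ) 1, ((1 - t ^ 2) ^ (((d : ℝ) - 2) / 2) : ℝ))⁻¹ *
    ∫ t in Set.Icc (-1 : ℝ) 1, f t * (1 - t ^ 2) ^ (((d : ℝ) - 2) / 2)

/-- `h_k² = ⟨G_k²⟩`. -/
noncomputable def hsqG (d k : ℕ) : ℝ := gInt d fun t => Geg d k t ^ 2

/-- Gegenbauer linearization coefficients `C_k^{ℓ,s} = ⟨G_ℓ G_s G_k⟩ / h_k²`. -/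
noncomputable def Ccoef (d k ℓ s : ℕ) : ℝ :=
  gInt d (fun t => Geg d ℓ t * Geg d s t * Geg d k t) / hsqG d k

/-- Convolution of sequences with respect to the Gegenbauer linearization coefficients. -/
noncomputable def gconv (d : ℕ) (mu nu : ℕ → ℝ) (k : ℕ) : ℝ :=
  ∑' ℓ : ℕ, ∑' s : ℕ, Ccoef d k ℓ s * mu ℓ * nu s

/-- Kernel `K_Λ̃(x,y) = ∑_ℓ λ̃_ℓ G_ℓ(x⋅y)` of the space `H_Λ̃` on the sphere. -/
noncomputable def sphKernel (d : ℕ) (lam : ℕ → ℝ)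
    (x y : EuclideanSpace ℝ (Fin (d + 1))) : ℝ :=
  ∑' ℓ : ℕ, lam ℓ * Geg d ℓ ⟪x, y⟫

/-- The squared optimal `n`-point quadrature error `e_n(H_Λ̃)²` for integration against the
normalized surface measure on `S^d` over the unit ball of the RKHS `H_Λ̃` with kernel
`K_Λ̃(x,y) = ∑_ℓ λ̃_ℓ G_ℓ(x⋅y)`.  It is expressed via the standard RKHS identity for the squared
worst-case error of the rule `(c, x)`:
`‖h₀‖² − 2 ∑_j c_j h₀(x_j) + ∑_{j,k} c_j c_k K(x_j,x_k)`, where the representer of integration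
is the constant `h₀ ≡ λ̃₀` with `‖h₀‖² = λ̃₀`. -/
noncomputable def enSq (d n : ℕ) (lam : ℕ → ℝ) : ℝ :=
  ⨅ (c : Fin n → ℝ)
    (x : Fin n → Metric.sphere (0 : EuclideanSpace ℝ (Fin (d + 1))) 1),
      (lam 0 - 2 * lam 0 * ∑ j, c j +
        ∑ j, ∑ k, c j * c k * sphKernel d lam (x j) (x k))

open MvPolynomial in
/-- Fischer pairing, as a linear functional of the second argument. -/
noncomputable def fis {m : ℕ} (q : MvPolynomial (Fin m) ℝ) : MvPolynomial (Fin m) ℝ →ₗ[ℝ] ℝ :=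
  (MvPolynomial.basisMonomials (Fin m) ℝ).constr ℝ
    (fun α => (∏ i, ((α i).factorial : ℝ)) * coeff α q)

open MvPolynomial in
lemma fis_monomial {m : ℕ} (q : MvPolynomial (Fin m) ℝ) (α : Fin m →₀ ℕ) (a : ℝ) :
    fis q (monomial α a) = a * ((∏ i, ((α i).factorial : ℝ)) * coeff α q) := by
  have h1 : (monomial α a : MvPolynomial (Fin m) ℝ) = a • (basisMonomials (Fin m) ℝ) α := by
    simp [smul_monomial]
  rw [h1, map_smul, fis, Module.Basis.constr_basis]
  rfl

open MvPolynomial in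
lemma fis_self_nonneg {m : ℕ} (q : MvPolynomial (Fin m) ℝ) : 0 ≤ fis q q := by
  conv_rhs => rw [q.as_sum]
  rw [map_sum]
  rw [← q.as_sum]
  apply Finset.sum_nonneg
  intro α _
  rw [fis_monomial]
  have : coeff α q * ((∏ i, ((α i).factorial : ℝ)) * coeff α q)
      = (∏ i, ((α i).factorial : ℝ)) * (coeff α q) ^ 2 := by ring
  rw [this]
  positivity

open MvPolynomial in
lemma fis_X_mul {m : ℕ} (q p : MvPolynomial (Fin m) ℝ) (i : Fin m) :
    fis q (X i * p) = fis (pderiv i q) p := by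
  induction p using MvPolynomial.induction_on' with
  | add p1 p2 h1 h2 => rw [mul_add, map_add, map_add, h1, h2]
  | monomial α a =>
    rw [X, monomial_mul, fis_monomial, fis_monomial, coeff_pderiv, add_comm (Finsupp.single i 1) α]
    have h : (∏ j, (((α + Finsupp.single i 1 : Fin m →₀ ℕ) j).factorial : ℝ))
        = (∏ j, ((α j).factorial : ℝ)) * (α i + 1) := by
      rw [← Finset.mul_prod_erase Finset.univ _ (Finset.mem_univ i),
        ← Finset.mul_prod_erase Finset.univ (fun j => ((α j).factorial : ℝ)) (Finset.mem_univ i)]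
      have : ∏ x ∈ Finset.univ.erase i, (((α + Finsupp.single i 1 : Fin m →₀ ℕ) x).factorial : ℝ)
          = ∏ x ∈ Finset.univ.erase i, ((α x).factorial : ℝ) := by
        apply Finset.prod_congr rfl
        intro x hx
        have hx' : i ≠ x := (Finset.ne_of_mem_erase hx).symm
        simp [Finsupp.single_apply, hx']
      rw [this]
      simp [Nat.factorial_succ]
      ring
    rw [h]
    ring

open MvPolynomial in
/-- The linear form `x ↦ x·y`. -/
noncomputable def Lf {m : ℕ} (y : Fin m → ℝ) : MvPolynomial (Fin m) ℝ := ∑ i, C (y i) * X i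

open MvPolynomial in
/-- The quadratic form `|x|²`. -/
noncomputable def Qf (m : ℕ) : MvPolynomial (Fin m) ℝ := ∑ i, X i * X i

open MvPolynomial in
/-- Directional derivative. -/
noncomputable def Dy {m : ℕ} (y : Fin m → ℝ) (p : MvPolynomial (Fin m) ℝ) :
    MvPolynomial (Fin m) ℝ := ∑ i, C (y i) * pderiv i p

open MvPolynomial in
/-- Laplacian. -/
noncomputable def Lap {m : ℕ} (p : MvPolynomial (Fin m) ℝ) :
    MvPolynomial (Fin m) ℝ := ∑ i, pderiv i (pderiv i p)

open MvPolynomial in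
lemma fis_Qf_mul {m : ℕ} (q p : MvPolynomial (Fin m) ℝ) :
    fis q (Qf m * p) = fis (Lap q) p := by
  have hadd : ∀ (s : Finset (Fin m)) (f : Fin m → MvPolynomial (Fin m) ℝ),
      fis (∑ i ∈ s, f i) p = ∑ i ∈ s, fis (f i) p := by
    intro s f
    induction p using MvPolynomial.induction_on' with
    | add p1 p2 h1 h2 => simp [map_add, h1, h2, Finset.sum_add_distrib]
    | monomial α a => simp [fis_monomial, coeff_sum, Finset.mul_sum]
  rw [Qf, Finset.sum_mul, map_sum, Lap, hadd]
  refine Finset.sum_congr rfl fun i _ => ?_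
  rw [mul_assoc, fis_X_mul, fis_X_mul]

open MvPolynomial in
lemma fis_Lf_pow {m : ℕ} (y : Fin m → ℝ) (n : ℕ) : ∀ q : MvPolynomial (Fin m) ℝ,
    q.IsHomogeneous n → fis q (Lf y ^ n) = n.factorial * eval y q := by
  induction n with
  | zero =>
    intro q hq
    have h0 : q = C (coeff 0 q) := totalDegree_eq_zero_iff_eq_C.1
      ((totalDegree_zero_iff_isHomogeneous (Fin m)).2 hq)
    have : (Lf y ^ 0 : MvPolynomial (Fin m) ℝ) = monomial 0 1 := by simp
    rw [this, fis_monomial]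
    conv_rhs => rw [h0]
    simp
  | succ n ih =>
    intro q hq
    have e := congrArg (eval y) hq.sum_X_mul_pderiv
    simp only [map_sum, map_mul, eval_X, map_nsmul] at e
    rw [pow_succ', Lf, Finset.sum_mul, map_sum, ← Lf]
    have : ∀ i, fis q (C (y i) * X i * Lf y ^ n)
        = n.factorial * (y i * eval y (pderiv i q)) := by
      intro i
      rw [mul_assoc, ← smul_eq_C_mul, map_smul, fis_X_mul, ih _ (by simpa using hq.pderiv (i := i))]
      simp only [smul_eq_mul]
      ring
    simp_rw [this]
    rw [← Finset.mul_sum, e, Nat.factorial_succ]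
    push_cast
    simp
    ring

open MvPolynomial in
/-- Homogenized zonal polynomials. -/
noncomputable def Zp (d : ℕ) (y : Fin (d + 1) → ℝ) : ℕ → MvPolynomial (Fin (d + 1)) ℝ
  | 0 => 1
  | 1 => Lf y
  | n + 2 => C (((2 * (n : ℝ) + 1 + d)) / ((n : ℝ) + d)) * (Lf y * Zp d y (n + 1))
      - C (((n : ℝ) + 1) / ((n : ℝ) + d)) * (Qf (d + 1) * Zp d y n)

open MvPolynomial in
lemma Lf_hom {m : ℕ} (y : Fin m → ℝ) : (Lf y).IsHomogeneous 1 := by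
  apply IsHomogeneous.sum
  intro i _
  simpa using (isHomogeneous_C (Fin m) (y i)).mul (isHomogeneous_X ℝ i)

open MvPolynomial in
lemma Qf_hom (m : ℕ) : (Qf m).IsHomogeneous 2 := by
  apply IsHomogeneous.sum
  intro i _
  exact (isHomogeneous_X ℝ i).mul (isHomogeneous_X ℝ i)

open MvPolynomial in
lemma Zp_hom (d : ℕ) (y : Fin (d + 1) → ℝ) (n : ℕ) : (Zp d y n).IsHomogeneous n := by
  induction n using Nat.twoStepInduction with
  | zero => exact isHomogeneous_one _ _
  | one => exact Lf_hom y
  | more n h0 h1 =>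
    rw [Zp]
    apply IsHomogeneous.sub
    · have := (isHomogeneous_C (Fin (d+1)) (((2 * (n : ℝ) + 1 + d)) / ((n : ℝ) + d))).mul
        ((Lf_hom y).mul h1)
      rwa [show 0 + (1 + (n + 1)) = n + 2 by omega] at this
    · have := (isHomogeneous_C (Fin (d+1)) (((n : ℝ) + 1) / ((n : ℝ) + d))).mul
        ((Qf_hom (d+1)).mul h0)
      rwa [show 0 + (2 + n) = n + 2 by omega] at this

open MvPolynomial in
lemma Dy_add {m : ℕ} (y : Fin m → ℝ) (p q : MvPolynomial (Fin m) ℝ) :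
    Dy y (p + q) = Dy y p + Dy y q := by simp [Dy, mul_add, Finset.sum_add_distrib]

open MvPolynomial in
lemma Dy_sub {m : ℕ} (y : Fin m → ℝ) (p q : MvPolynomial (Fin m) ℝ) :
    Dy y (p - q) = Dy y p - Dy y q := by simp [Dy, mul_sub, Finset.sum_sub_distrib]

open MvPolynomial in
lemma Dy_C_mul {m : ℕ} (y : Fin m → ℝ) (a : ℝ) (p : MvPolynomial (Fin m) ℝ) :
    Dy y (C a * p) = C a * Dy y p := by
  simp only [Dy, pderiv_C_mul, Finset.mul_sum]
  exact Finset.sum_congr rfl fun i _ => by ring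

open MvPolynomial in
lemma Dy_mul {m : ℕ} (y : Fin m → ℝ) (p q : MvPolynomial (Fin m) ℝ) :
    Dy y (p * q) = Dy y p * q + p * Dy y q := by
  simp only [Dy, pderiv_mul, Finset.mul_sum, Finset.sum_mul, ← Finset.sum_add_distrib]
  exact Finset.sum_congr rfl fun i _ => by ring

open MvPolynomial in
lemma pderiv_Lf {m : ℕ} (y : Fin m → ℝ) (i : Fin m) : pderiv i (Lf y) = C (y i) := by
  classical
  simp [Lf, pderiv_C_mul, pderiv_X, Pi.single_apply]

open MvPolynomial in
lemma pderiv_Qf {m : ℕ} (i : Fin m) : pderiv i (Qf m) = 2 * X i := by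
  classical
  simp [Qf, pderiv_mul, pderiv_X, Pi.single_apply, Finset.sum_add_distrib]
  ring

open MvPolynomial in
lemma Dy_Lf {m : ℕ} (y : Fin m → ℝ) (hy : ∑ i, y i * y i = 1) : Dy y (Lf y) = 1 := by
  simp only [Dy, pderiv_Lf, ← C_mul, ← map_sum, hy]
  simp

open MvPolynomial in
lemma Dy_Qf {m : ℕ} (y : Fin m → ℝ) : Dy y (Qf m) = 2 * Lf y := by
  simp only [Dy, pderiv_Qf, Lf, Finset.mul_sum]
  exact Finset.sum_congr rfl fun i _ => by ring

open MvPolynomial in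
lemma Lap_Lf_mul {m : ℕ} (y : Fin m → ℝ) (p : MvPolynomial (Fin m) ℝ) :
    Lap (Lf y * p) = 2 * Dy y p + Lf y * Lap p := by
  simp only [Lap, Dy, pderiv_mul, pderiv_Lf, map_add, pderiv_C, Finset.mul_sum,
    ← Finset.sum_add_distrib]
  exact Finset.sum_congr rfl fun i _ => by ring

open MvPolynomial in
lemma Lap_Qf_mul {m n : ℕ} (p : MvPolynomial (Fin m) ℝ) (hp : p.IsHomogeneous n) :
    Lap (Qf m * p) = C (2 * (m : ℝ) + 4 * (n : ℝ)) * p + Qf m * Lap p := by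
  have e := hp.sum_X_mul_pderiv
  have h2 : ∀ i : Fin m, pderiv i (2 * X i : MvPolynomial (Fin m) ℝ) = 2 := by
    intro i
    have : (2 : MvPolynomial (Fin m) ℝ) = C 2 := (map_ofNat C 2).symm
    rw [this, pderiv_C_mul]; simp
  have : Lap (Qf m * p) = ∑ i : Fin m, (2 * p + 4 * (X i * pderiv i p)
      + Qf m * pderiv i (pderiv i p)) := by
    simp only [Lap, pderiv_mul, pderiv_Qf, map_add, h2]
    exact Finset.sum_congr rfl fun i _ => by
      ring
  rw [this, Finset.sum_add_distrib, Finset.sum_add_distrib, ← Finset.mul_sum, ← Finset.mul_sum,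
    ← Finset.mul_sum, e, Lap]
  simp only [map_add, map_mul, map_natCast, map_ofNat, Finset.sum_const, Finset.card_univ,
    Fintype.card_fin, nsmul_eq_mul]
  ring

open MvPolynomial in
lemma Lap_sub {m : ℕ} (p q : MvPolynomial (Fin m) ℝ) :
    Lap (p - q) = Lap p - Lap q := by simp [Lap, Finset.sum_sub_distrib]

open MvPolynomial in
lemma Lap_C_mul {m : ℕ} (a : ℝ) (p : MvPolynomial (Fin m) ℝ) :
    Lap (C a * p) = C a * Lap p := by
  simp only [Lap, pderiv_C_mul, Finset.mul_sum]

open MvPolynomial in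
lemma Zp_rec (d : ℕ) (hd : 2 ≤ d) (y : Fin (d + 1) → ℝ) (n : ℕ) :
    C ((n : ℝ) + d) * Zp d y (n + 2) = C (2 * (n : ℝ) + 1 + d) * (Lf y * Zp d y (n + 1))
      - C ((n : ℝ) + 1) * (Qf (d + 1) * Zp d y n) := by
  have h : ((n : ℝ) + d) ≠ 0 := by positivity
  rw [Zp, mul_sub, ← mul_assoc, ← mul_assoc (C ((n : ℝ) + d)), ← C_mul, ← C_mul,
    mul_div_cancel₀ _ h, mul_div_cancel₀ _ h]

open MvPolynomial in
lemma Dy_Zp (d : ℕ) (hd : 2 ≤ d) (y : Fin (d + 1) → ℝ) (hy : ∑ i, y i * y i = 1) (n : ℕ) :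
    Dy y (Zp d y (n + 1)) = C ((n : ℝ) + 1) * Zp d y n := by
  induction n using Nat.twoStepInduction with
  | zero => simp [Zp, Dy_Lf y hy]
  | one =>
    have h : (C ((0 : ℕ) + d : ℝ) : MvPolynomial (Fin (d+1)) ℝ) ≠ 0 := by
      rw [Ne, C_eq_zero]; positivity
    apply mul_left_cancel₀ h
    rw [← Dy_C_mul, Zp_rec d hd]
    have h1 : Dy y (1 : MvPolynomial (Fin (d+1)) ℝ) = 0 := by simp [Dy]
    have z1 : Zp d y (0 + 1) = Lf y := rfl
    have z0 : Zp d y 0 = 1 := rfl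
    rw [z1, z0, Dy_sub, Dy_C_mul, Dy_C_mul, Dy_mul, Dy_mul, Dy_Lf y hy, Dy_Qf, h1]
    simp [z1]
    ring
  | more n h0 h1 =>
    have r1 := Zp_rec d hd y n
    have r2 := congrArg (Dy y) (Zp_rec d hd y (n + 1))
    rw [Dy_C_mul, Dy_sub, Dy_C_mul, Dy_C_mul, Dy_mul, Dy_mul, Dy_Lf y hy, Dy_Qf, h1, h0] at r2
    have h : (C (((n + 1 : ℕ) : ℝ) + d : ℝ) : MvPolynomial (Fin (d+1)) ℝ) ≠ 0 := by
      rw [Ne, C_eq_zero]; positivity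
    apply mul_left_cancel₀ h
    rw [show n + 2 + 1 = n + 1 + 2 from rfl, r2]
    simp only [map_add, map_mul, C_1, map_natCast, map_ofNat, Nat.cast_add, Nat.cast_one,
      Nat.cast_ofNat] at r1 ⊢
    linear_combination (-(n:MvPolynomial (Fin (d+1)) ℝ) - 2) * r1

open MvPolynomial in
lemma Lap_Zp (d : ℕ) (hd : 2 ≤ d) (y : Fin (d + 1) → ℝ) (hy : ∑ i, y i * y i = 1) (n : ℕ) :
    Lap (Zp d y n) = 0 := by
  induction n using Nat.twoStepInduction with
  | zero => simp [Zp, Lap]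
  | one => simp [Zp, Lap, pderiv_Lf]
  | more n h0 h1 =>
    have h : (C (((n : ℕ) : ℝ) + d : ℝ) : MvPolynomial (Fin (d+1)) ℝ) ≠ 0 := by
      rw [Ne, C_eq_zero]; positivity
    apply mul_left_cancel₀ h
    rw [← Lap_C_mul, Zp_rec d hd, Lap_sub, Lap_C_mul, Lap_C_mul, Lap_Lf_mul,
      Lap_Qf_mul _ (Zp_hom d y n), h0, h1, Dy_Zp d hd y hy]
    simp only [map_add, map_mul, C_1, map_natCast, map_ofNat, Nat.cast_add, Nat.cast_one]
    ring

open MvPolynomial in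
lemma Zp_lead (d : ℕ) (hd : 2 ≤ d) (n : ℕ) : ∃ a : ℝ, 0 < a ∧ ∀ y : Fin (d + 1) → ℝ,
    ∃ R, Zp d y n = C a * Lf y ^ n + Qf (d + 1) * R := by
  induction n using Nat.twoStepInduction with
  | zero => exact ⟨1, one_pos, fun y => ⟨0, by simp [Zp]⟩⟩
  | one => exact ⟨1, one_pos, fun y => ⟨0, by simp [Zp]⟩⟩
  | more n _ h1 =>
    obtain ⟨a, ha, h⟩ := h1
    refine ⟨(2 * (n : ℝ) + 1 + d) / (n + d) * a, by positivity, fun y => ?_⟩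
    obtain ⟨R, hR⟩ := h y
    refine ⟨C ((2 * (n : ℝ) + 1 + d) / (n + d)) * Lf y * R
      - C (((n : ℝ) + 1) / ((n : ℝ) + d)) * Zp d y n, ?_⟩
    rw [Zp, hR, C_mul]
    ring

open MvPolynomial in
lemma eval_Zp (d : ℕ) (x y : Fin (d + 1) → ℝ) (hx : ∑ i, x i * x i = 1) (n : ℕ) :
    eval x (Zp d y n) = Geg d n (∑ i, x i * y i) := by
  have hL : eval x (Lf y) = ∑ i, x i * y i := by
    simp [Lf]; exact Finset.sum_congr rfl fun i _ => mul_comm _ _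
  have hQ : eval x (Qf (d + 1)) = 1 := by simp [Qf, hx]
  induction n using Nat.twoStepInduction with
  | zero => simp [Zp, Geg]
  | one => simp [Zp, Geg, hL]
  | more n h0 h1 =>
    simp only [Zp, Geg, map_sub, map_mul, eval_C, hL, hQ, h0, h1]
    ring

open MvPolynomial in
/-- Schoenberg: positive definiteness. -/
lemma geg_psd' (d : ℕ) (hd : 2 ≤ d) (n N : ℕ) (x : Fin N → Fin (d + 1) → ℝ)
    (hx : ∀ j, ∑ i, x j i * x j i = 1) (c : Fin N → ℝ) :
    0 ≤ ∑ j, ∑ k, c j * c k * Geg d n (∑ i, x j i * x k i) := by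
  obtain ⟨a, ha, hlead⟩ := Zp_lead d hd n
  set h : MvPolynomial (Fin (d + 1)) ℝ := ∑ j, C (c j) * Zp d (x j) n with hh
  have hhom : h.IsHomogeneous n := by
    apply IsHomogeneous.sum
    intro j _
    simpa using (isHomogeneous_C (Fin (d + 1)) (c j)).mul (Zp_hom d (x j) n)
  have hlap : Lap h = 0 := by
    have : Lap h = ∑ j, Lap (C (c j) * Zp d (x j) n) := by
      simp only [hh, Lap, map_sum]
      rw [Finset.sum_comm]
    rw [this]
    exact Finset.sum_eq_zero fun j _ => by rw [Lap_C_mul, Lap_Zp d hd _ (hx j), mul_zero]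
  have h0 : ∀ p, fis (0 : MvPolynomial (Fin (d + 1)) ℝ) p = 0 := by
    intro p
    induction p using MvPolynomial.induction_on' with
    | add p1 p2 h1 h2 => rw [map_add, h1, h2, add_zero]
    | monomial α a => simp [fis_monomial]
  have key : fis h h = a * n.factorial * ∑ j, ∑ k, c j * c k * Geg d n (∑ i, x j i * x k i) := by
    conv_lhs => arg 2; rw [hh]
    rw [map_sum, Finset.mul_sum]
    refine Finset.sum_congr rfl fun j _ => ?_
    obtain ⟨R, hR⟩ := hlead (x j)
    rw [← smul_eq_C_mul, map_smul, hR, map_add, fis_Qf_mul, hlap, h0, ← smul_eq_C_mul, map_smul,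
      fis_Lf_pow _ _ _ hhom]
    simp only [hh, map_sum, map_mul, eval_C, eval_Zp d _ _ (hx j), smul_eq_mul, Finset.mul_sum,
      add_zero]
    exact Finset.sum_congr rfl fun k _ => by ring
  have hp : 0 < a * n.factorial := by positivity
  have := fis_self_nonneg h
  rw [key] at this
  exact nonneg_of_mul_nonneg_right this hp
lemma geg_cont (d n : ℕ) : Continuous (Geg d n) := by
  induction n using Nat.twoStepInduction with
  | zero => simp only [Geg]; fun_prop
  | one => simp only [Geg]; fun_prop
  | more n h0 h1 => simp only [Geg]; fun_prop

lemma geg_one (d : ℕ) (hd : 2 ≤ d) (n : ℕ) : Geg d n 1 = 1 := by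
  induction n using Nat.twoStepInduction with
  | zero => simp [Geg]
  | one => simp [Geg]
  | more n h0 h1 =>
    have : ((n : ℝ) + d) ≠ 0 := by positivity
    simp only [Geg, h0, h1]
    field_simp
    ring

lemma geg_abs_le (d : ℕ) (hd : 2 ≤ d) (n : ℕ) (t : ℝ) (ht : t ∈ Set.Icc (-1 : ℝ) 1) :
    |Geg d n t| ≤ 1 := by
  obtain ⟨e, rfl⟩ : ∃ e, d = e + 1 := ⟨d - 1, by omega⟩
  have hs : 0 ≤ 1 - t ^ 2 := by nlinarith [ht.1, ht.2]
  set s := Real.sqrt (1 - t ^ 2) with hsd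
  have hss : s * s = 1 - t ^ 2 := Real.mul_self_sqrt hs
  let u : Fin (e + 1 + 1) → ℝ := Fin.cons 1 (fun _ => 0)
  let v : Fin (e + 1 + 1) → ℝ := Fin.cons t (Fin.cons s (fun _ => 0))
  have huu : ∑ i, u i * u i = 1 := by simp [u, Fin.sum_univ_succ]
  have hvv : ∑ i, v i * v i = 1 := by
    simp [v, Fin.sum_univ_succ, hss]; ring
  have huv : ∑ i, u i * v i = t := by simp [u, v, Fin.sum_univ_succ]
  have hvu : ∑ i, v i * u i = t := by simp [u, v, Fin.sum_univ_succ]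
  have hx : ∀ j : Fin 2, ∑ i, (![u, v] j) i * (![u, v] j) i = 1 := by
    intro j; fin_cases j
    · exact huu
    · exact hvv
  have key : ∀ b : ℝ, 0 ≤ 1 + b * b + 2 * b * Geg (e + 1) n t := by
    intro b
    have := geg_psd' (e + 1) hd n 2 ![u, v] hx ![1, b]
    simp only [Fin.sum_univ_two, Matrix.cons_val_zero, Matrix.cons_val_one,
      huu, hvv, huv, hvu, geg_one _ hd] at this
    linarith
  rw [abs_le]
  constructor <;> linarith [key 1, key (-1)]

open Polynomial in
/-- Gegenbauer polynomials as polynomials. -/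
noncomputable def gp (d : ℕ) : ℕ → ℝ[X]
  | 0 => 1
  | 1 => X
  | n + 2 => C (((2 * (n : ℝ) + 1 + d)) / ((n : ℝ) + d)) * (X * gp d (n + 1))
      - C (((n : ℝ) + 1) / ((n : ℝ) + d)) * gp d n

open Polynomial in
lemma eval_gp (d n : ℕ) (t : ℝ) : (gp d n).eval t = Geg d n t := by
  induction n using Nat.twoStepInduction with
  | zero => simp [gp, Geg]
  | one => simp [gp, Geg]
  | more n h0 h1 =>
    simp only [gp, Geg, eval_sub, eval_mul, eval_C, eval_X, h0, h1]
    ring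

open Polynomial in
lemma gp_rec (d : ℕ) (hd : 2 ≤ d) (n : ℕ) :
    ((n : ℝ[X]) + (d : ℝ[X])) * gp d (n + 2) = (2 * (n : ℝ[X]) + 1 + (d : ℝ[X])) * (X * gp d (n + 1))
      - ((n : ℝ[X]) + 1) * gp d n := by
  have h : ((n : ℝ) + d) ≠ 0 := by positivity
  have h1 : ((n : ℝ[X]) + (d : ℝ[X])) = C ((n : ℝ) + d) := by simp
  have h2 : (2 * (n : ℝ[X]) + 1 + (d : ℝ[X])) = C (2 * (n : ℝ) + 1 + d) := by
    simp only [map_add, map_mul, map_natCast, map_ofNat, C_1]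
  have h3 : ((n : ℝ[X]) + 1) = C ((n : ℝ) + 1) := by simp
  rw [h1, h2, h3, gp, mul_sub, ← mul_assoc, ← mul_assoc (C ((n : ℝ) + d)), ← C_mul, ← C_mul,
    mul_div_cancel₀ _ h, mul_div_cancel₀ _ h]

open Polynomial in
lemma gp_ne (d : ℕ) (hd : 2 ≤ d) (n : ℕ) : ((n : ℝ[X]) + (d : ℝ[X])) ≠ 0 := by
  have h : ((n : ℝ) + d) ≠ 0 := by positivity
  have h1 : ((n : ℝ[X]) + (d : ℝ[X])) = C ((n : ℝ) + d) := by simp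
  rw [h1, Ne, C_eq_zero]
  exact h

open Polynomial in
lemma gp_deriv (d : ℕ) (hd : 2 ≤ d) (n : ℕ) :
    (1 - X ^ 2) * derivative (gp d (n + 1)) = ((n : ℝ[X]) + 1) * (gp d n - X * gp d (n + 1)) := by
  induction n using Nat.twoStepInduction with
  | zero => simp [gp]; ring
  | one =>
    have r := gp_rec d hd 0
    have r' := congrArg derivative r
    have z1 : gp d (0 + 1) = X := rfl
    have z2 : gp d 1 = X := rfl
    have z0 : gp d 0 = 1 := rfl
    simp only [z0, z1, z2, Nat.cast_zero, derivative_mul, derivative_sub, derivative_add,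
      derivative_X, derivative_natCast, derivative_one, zero_add, derivative_ofNat, mul_zero,
      Nat.cast_one] at r r' ⊢
    apply mul_left_cancel₀ (gp_ne d hd 0)
    simp only [Nat.cast_zero, zero_add]
    linear_combination (1 - X ^ 2) * r' + 2 * X * r
  | more n h0 h1 =>
    have r0 := gp_rec d hd n
    have r := gp_rec d hd (n + 1)
    have r' := congrArg derivative r
    simp only [derivative_mul, derivative_sub, derivative_add,
      derivative_X, derivative_natCast, derivative_one, zero_add, derivative_ofNat, mul_zero,
      Nat.cast_one, zero_mul, Nat.cast_add, add_zero, one_mul] at r r' h1 ⊢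
    apply mul_left_cancel₀ (gp_ne d hd (n + 1))
    simp only [Nat.cast_add, Nat.cast_one, Nat.cast_ofNat]
    linear_combination (1 - X ^ 2) * r' + (2 * (n : ℝ[X]) + 3 + (d : ℝ[X])) * X * h1
      - ((n : ℝ[X]) + 2) * h0 - ((n : ℝ[X]) + 2) * r0 + ((n : ℝ[X]) + 3) * X * r

open Polynomial in
lemma gp_deriv2 (d : ℕ) (hd : 2 ≤ d) (n : ℕ) :
    (1 - X ^ 2) * derivative (gp d n)
      = ((n : ℝ[X]) + (d : ℝ[X]) - 1) * (X * gp d n - gp d (n + 1)) := by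
  cases n with
  | zero => simp [gp]
  | succ n =>
    rw [gp_deriv d hd]
    have := gp_rec d hd n
    push_cast
    linear_combination this

open Polynomial in
lemma gp_ode (d : ℕ) (hd : 2 ≤ d) (n : ℕ) :
    (1 - X ^ 2) * derivative (derivative (gp d n)) =
      (d : ℝ[X]) * X * derivative (gp d n) - (n : ℝ[X]) * ((n : ℝ[X]) + (d : ℝ[X]) - 1) * gp d n := by
  cases n with
  | zero => simp [gp]
  | succ n =>
    have hX : (1 - X ^ 2 : ℝ[X]) ≠ 0 := by
      intro h
      have := congrArg (eval 0) h
      simp at this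
    have a := gp_deriv d hd n
    have a' := congrArg derivative a
    have b := gp_deriv2 d hd n
    have hq : derivative (1 - X ^ 2 : ℝ[X]) = -2 * X := by
      simp only [derivative_sub, derivative_one, derivative_X_pow, Nat.cast_ofNat]
      simp
      exact map_ofNat C 2
    have hn : derivative ((n : ℝ[X]) + 1) = 0 := by simp
    rw [derivative_mul, hq, derivative_mul, hn, derivative_sub, derivative_mul, derivative_X] at a'
    apply mul_left_cancel₀ hX
    push_cast
    linear_combination (1 - X ^ 2) * a' + (1 - (d : ℝ[X]) - (n : ℝ[X])) * X * a
      + ((n : ℝ[X]) + 1) * b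
/-- The Gegenbauer weight. -/
noncomputable def wgt (d : ℕ) (t : ℝ) : ℝ := (1 - t ^ 2) ^ (((d : ℝ) - 2) / 2)

lemma wgt_cont (d : ℕ) (hd : 2 ≤ d) : Continuous (wgt d) := by
  have h : (0 : ℝ) ≤ ((d : ℝ) - 2) / 2 := by
    have : (2 : ℝ) ≤ d := by exact_mod_cast hd
    linarith
  unfold wgt
  exact Continuous.rpow_const (by fun_prop) fun _ => Or.inr h

lemma wgt_nonneg (d : ℕ) (t : ℝ) (ht : t ∈ Set.Icc (-1 : ℝ) 1) : 0 ≤ wgt d t :=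
  Real.rpow_nonneg (by nlinarith [ht.1, ht.2]) _

lemma wgt_pos (d : ℕ) (t : ℝ) (ht : t ∈ Set.Ioo (-1 : ℝ) 1) : 0 < wgt d t :=
  Real.rpow_pos_of_pos (by nlinarith [ht.1, ht.2]) _

/-- Weighted integral. -/
noncomputable def II (d : ℕ) (f : ℝ → ℝ) : ℝ := ∫ t in Set.Icc (-1 : ℝ) 1, f t * wgt d t

lemma II_int (d : ℕ) (hd : 2 ≤ d) (f : ℝ → ℝ) (hf : ContinuousOn f (Set.Icc (-1) 1)) :
    IntegrableOn (fun t => f t * wgt d t) (Set.Icc (-1 : ℝ) 1) :=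
  (hf.mul (wgt_cont d hd).continuousOn).integrableOn_compact isCompact_Icc

lemma II_zero (d : ℕ) (hd : 2 ≤ d) (f : ℝ → ℝ) (hf : ContinuousOn f (Set.Icc (-1) 1))
    (hf0 : ∀ t ∈ Set.Icc (-1 : ℝ) 1, 0 ≤ f t) (h : II d f = 0) :
    ∀ t ∈ Set.Icc (-1 : ℝ) 1, f t = 0 := by
  have h1 : (fun t => f t * wgt d t) =ᵐ[volume.restrict (Set.Icc (-1 : ℝ) 1)] 0 := by
    refine (setIntegral_eq_zero_iff_of_nonneg_ae ?_ (II_int d hd f hf)).1 h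
    filter_upwards [ae_restrict_mem measurableSet_Icc] with t ht
    exact mul_nonneg (hf0 t ht) (wgt_nonneg d t ht)
  have h2 := Measure.eqOn_Icc_of_ae_eq volume (by norm_num : (-1 : ℝ) ≠ 1) h1
    (hf.mul (wgt_cont d hd).continuousOn) continuousOn_const
  have h3 : Set.EqOn f 0 (Set.Ioo (-1 : ℝ) 1) := by
    intro t ht
    have := h2 (Set.Ioo_subset_Icc_self ht)
    simp only [Pi.zero_apply, mul_eq_zero] at this
    exact this.resolve_right (wgt_pos d t ht).ne'
  exact h3.of_subset_closure hf continuousOn_const Set.Ioo_subset_Icc_self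
    (by rw [closure_Ioo (by norm_num)])

lemma II_orth (d : ℕ) (hd : 2 ≤ d) (n m : ℕ) (hnm : n ≠ m) :
    II d (fun t => Geg d n t * Geg d m t) = 0 := by
  have hd' : (2 : ℝ) ≤ d := by exact_mod_cast hd
  let p := gp d n
  let q := gp d m
  let W : Polynomial ℝ := p.derivative * q - p * q.derivative
  let F : ℝ → ℝ := fun t => (1 - t ^ 2) ^ ((d : ℝ) / 2) * W.eval t
  let κ : ℝ := (m : ℝ) * (m + d - 1) - (n : ℝ) * (n + d - 1)
  have hF : ∀ t ∈ Set.Ioo (-1 : ℝ) 1,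
      HasDerivAt F (κ * (Geg d n t * Geg d m t * wgt d t)) t := by
    intro t ht
    have hpos : 0 < 1 - t ^ 2 := by nlinarith [ht.1, ht.2]
    have h1 : HasDerivAt (fun t : ℝ => 1 - t ^ 2) (-(2 * t)) t := by
      have := ((hasDerivAt_id t).pow 2).const_sub 1
      simpa using this
    have h2 := (h1.rpow_const (p := (d : ℝ) / 2) (Or.inl hpos.ne')).mul (W.hasDerivAt t)
    refine HasDerivAt.congr_deriv h2 ?_
    have e1 : (1 - t ^ 2) ^ ((d : ℝ) / 2) = wgt d t * (1 - t ^ 2) := by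
      rw [wgt, ← Real.rpow_add_one hpos.ne']; congr 1; ring
    have e2 : (1 - t ^ 2) ^ ((d : ℝ) / 2 - 1) = wgt d t := by
      rw [wgt]; congr 1; ring
    have o1 := congrArg (Polynomial.eval t) (gp_ode d hd n)
    have o2 := congrArg (Polynomial.eval t) (gp_ode d hd m)
    simp only [Polynomial.eval_mul, Polynomial.eval_sub, Polynomial.eval_add, Polynomial.eval_one,
      Polynomial.eval_pow, Polynomial.eval_X, Polynomial.eval_natCast] at o1 o2
    rw [e1, e2]
    simp only [W, p, q, κ, Polynomial.derivative_sub, Polynomial.derivative_mul,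
      Polynomial.eval_mul, Polynomial.eval_sub, Polynomial.eval_add, ← eval_gp]
    linear_combination wgt d t * ((gp d m).eval t) * o1 - wgt d t * ((gp d n).eval t) * o2
  have hFc : Continuous F := by
    apply Continuous.mul
    · exact Continuous.rpow_const (by fun_prop) fun _ => Or.inr (by positivity)
    · exact W.continuous
  have hG : Continuous (fun t => κ * (Geg d n t * Geg d m t * wgt d t)) := by
    have := geg_cont d n
    have := geg_cont d m
    have := wgt_cont d hd
    fun_prop
  have key := intervalIntegral.integral_eq_sub_of_hasDerivAt_of_le (by norm_num : (-1 : ℝ) ≤ 1)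
    hFc.continuousOn hF (hG.intervalIntegrable _ _)
  have hz : (0 : ℝ) ^ ((d : ℝ) / 2) = 0 := Real.zero_rpow (by positivity)
  have hF1 : F 1 = 0 := by simp [F, hz]
  have hF2 : F (-1) = 0 := by simp [F, hz]
  rw [hF1, hF2, sub_zero, intervalIntegral.integral_const_mul,
    intervalIntegral.integral_of_le (by norm_num), ← integral_Icc_eq_integral_Ioc] at key
  have hκ : κ ≠ 0 := by
    have : κ = ((m : ℝ) - n) * (m + n + d - 1) := by simp only [κ]; ring
    rw [this]
    apply mul_ne_zero
    · rw [sub_ne_zero]; exact_mod_cast hnm.symm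
    · have : (0 : ℝ) ≤ m := Nat.cast_nonneg m
      have : (0 : ℝ) ≤ n := Nat.cast_nonneg n
      linarith
  exact (mul_eq_zero.1 key).resolve_left hκ

lemma II_add (d : ℕ) (hd : 2 ≤ d) (f g : ℝ → ℝ) (hf : ContinuousOn f (Set.Icc (-1) 1))
    (hg : ContinuousOn g (Set.Icc (-1) 1)) :
    II d (fun t => f t + g t) = II d f + II d g := by
  unfold II
  rw [← integral_add (II_int d hd f hf) (II_int d hd g hg)]
  simp only [add_mul]

lemma II_smul (d : ℕ) (c : ℝ) (f : ℝ → ℝ) :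
    II d (fun t => c * f t) = c * II d f := by
  unfold II
  rw [← integral_const_mul]
  simp only [mul_assoc]

lemma II_sub (d : ℕ) (hd : 2 ≤ d) (f g : ℝ → ℝ) (hf : ContinuousOn f (Set.Icc (-1) 1))
    (hg : ContinuousOn g (Set.Icc (-1) 1)) :
    II d (fun t => f t - g t) = II d f - II d g := by
  unfold II
  rw [← integral_sub (II_int d hd f hf) (II_int d hd g hg)]
  simp only [sub_mul]

lemma II_mono (d : ℕ) (hd : 2 ≤ d) (f g : ℝ → ℝ) (hf : ContinuousOn f (Set.Icc (-1) 1))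
    (hg : ContinuousOn g (Set.Icc (-1) 1)) (h : ∀ t ∈ Set.Icc (-1 : ℝ) 1, f t ≤ g t) :
    II d f ≤ II d g :=
  setIntegral_mono_on (II_int d hd f hf) (II_int d hd g hg) measurableSet_Icc
    fun t ht => mul_le_mul_of_nonneg_right (h t ht) (wgt_nonneg d t ht)

lemma complete_pow (d : ℕ) (hd : 2 ≤ d) (f : ℝ → ℝ) (hf : ContinuousOn f (Set.Icc (-1) 1))
    (h : ∀ k, II d (fun t => f t * Geg d k t) = 0) (j : ℕ) :
    ∀ k, II d (fun t => f t * (t ^ j * Geg d k t)) = 0 := by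
  induction j with
  | zero => simpa using h
  | succ j ih =>
    intro k
    cases k with
    | zero =>
      rw [← ih 1]
      congr 1
      funext t
      simp only [Geg]; ring
    | succ k =>
      have hk : (2 * (k : ℝ) + 1 + d) ≠ 0 := by positivity
      have hk' : ((k : ℝ) + d) ≠ 0 := by positivity
      have : (fun t => f t * (t ^ (j + 1) * Geg d (k + 1) t)) =
          fun t => ((k : ℝ) + d) / (2 * (k : ℝ) + 1 + d) * (f t * (t ^ j * Geg d (k + 2) t))
            + ((k : ℝ) + 1) / (2 * (k : ℝ) + 1 + d) * (f t * (t ^ j * Geg d k t)) := by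
        funext t
        simp only [Geg]
        field_simp
        ring
      have c1 := geg_cont d k
      have c2 := geg_cont d (k + 2)
      rw [this, II_add d hd _ _ (by fun_prop) (by fun_prop), II_smul, II_smul, ih, ih]
      simp

lemma complete_poly (d : ℕ) (hd : 2 ≤ d) (f : ℝ → ℝ) (hf : ContinuousOn f (Set.Icc (-1) 1))
    (h : ∀ k, II d (fun t => f t * Geg d k t) = 0) (p : Polynomial ℝ) :
    II d (fun t => f t * p.eval t) = 0 := by
  induction p using Polynomial.induction_on' with
  | add p q hp hq =>
    have c1 := p.continuous
    have c2 := q.continuous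
    simp only [Polynomial.eval_add, mul_add]
    rw [II_add d hd (fun t => f t * p.eval t) (fun t => f t * q.eval t) (hf.mul c1.continuousOn) (hf.mul c2.continuousOn), hp, hq, add_zero]
  | monomial n a =>
    have := complete_pow d hd f hf h n 0
    have e : (fun t => f t * (Polynomial.monomial n a).eval t)
        = fun t => a * (f t * (t ^ n * Geg d 0 t)) := by
      funext t; simp [Geg]; ring
    rw [e, II_smul, this, mul_zero]

lemma complete (d : ℕ) (hd : 2 ≤ d) (f : ℝ → ℝ) (hf : ContinuousOn f (Set.Icc (-1) 1))
    (h : ∀ k, II d (fun t => f t * Geg d k t) = 0) : ∀ t ∈ Set.Icc (-1 : ℝ) 1, f t = 0 := by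
  have hff : II d (fun t => f t * f t) = 0 := by
    have hle : ∀ ε > 0, II d (fun t => f t * f t) ≤ ε * II d (fun t => |f t|) := by
      intro ε hε
      obtain ⟨p, hp⟩ := exists_polynomial_near_of_continuousOn (-1) 1 f hf ε hε
      have c1 : ContinuousOn (fun t => p.eval t) (Set.Icc (-1) 1) := p.continuous.continuousOn
      have e : II d (fun t => f t * f t) = II d (fun t => f t * f t - f t * p.eval t) := by
        rw [II_sub d hd (fun t => f t * f t) (fun t => f t * p.eval t) (hf.mul hf) (hf.mul c1), complete_poly d hd f hf h p, sub_zero]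
      rw [e, ← II_smul]
      apply II_mono d hd _ _ ((hf.mul hf).sub (hf.mul c1)) (continuousOn_const.mul hf.abs)
      intro t ht
      have := hp t ht
      calc f t * f t - f t * p.eval t ≤ |f t * f t - f t * p.eval t| := le_abs_self _
        _ = |f t| * |p.eval t - f t| := by rw [← mul_sub, abs_mul, abs_sub_comm]
        _ ≤ |f t| * ε := by gcongr
        _ = _ := mul_comm _ _
    have h0 : ∀ g : ℝ → ℝ, ContinuousOn g (Set.Icc (-1) 1) → (∀ t, 0 ≤ g t) → 0 ≤ II d g := by
      intro g hg hg0
      have := II_mono d hd (fun _ => 0) g continuousOn_const hg fun t _ => hg0 t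
      simpa [II] using this
    have hA := h0 (fun t => |f t|) hf.abs fun t => abs_nonneg _
    have hB := h0 (fun t => f t * f t) (hf.mul hf) fun t => mul_self_nonneg _
    apply le_antisymm _ hB
    apply le_of_forall_pos_le_add
    intro ε hε
    have := hle (ε / (II d (fun t => |f t|) + 1)) (by positivity)
    have h2 : ε / (II d (fun t => |f t|) + 1) * II d (fun t => |f t|) ≤ ε := by
      rw [div_mul_eq_mul_div, div_le_iff₀ (by positivity)]
      nlinarith
    linarith
  intro t ht
  have := II_zero d hd _ (hf.mul hf) (fun t _ => mul_self_nonneg _) hff t ht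
  exact mul_self_eq_zero.1 this

/-- The kernel profile. -/
noncomputable def Kf (d : ℕ) (a : ℕ → ℝ) (t : ℝ) : ℝ := ∑' ℓ : ℕ, a ℓ * Geg d ℓ t

lemma Kf_bd (d : ℕ) (hd : 2 ≤ d) (a : ℕ → ℝ) (ha0 : ∀ k, 0 ≤ a k) (l : ℕ) (t : ℝ)
    (ht : t ∈ Set.Icc (-1 : ℝ) 1) : ‖a l * Geg d l t‖ ≤ a l := by
  rw [norm_mul, Real.norm_of_nonneg (ha0 l)]
  exact mul_le_of_le_one_right (ha0 l) (geg_abs_le d hd l t ht)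

lemma Kf_summable (d : ℕ) (hd : 2 ≤ d) (a : ℕ → ℝ) (ha0 : ∀ k, 0 ≤ a k) (ha : Summable a) (t : ℝ)
    (ht : t ∈ Set.Icc (-1 : ℝ) 1) : Summable fun l => a l * Geg d l t :=
  ha.of_norm_bounded fun l => Kf_bd d hd a ha0 l t ht

lemma Kf_cont (d : ℕ) (hd : 2 ≤ d) (a : ℕ → ℝ) (ha0 : ∀ k, 0 ≤ a k) (ha : Summable a) :
    ContinuousOn (Kf d a) (Set.Icc (-1) 1) :=
  continuousOn_tsum (fun l => (continuous_const.mul (geg_cont d l)).continuousOn) ha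
    fun l t ht => Kf_bd d hd a ha0 l t ht

lemma II_Kf (d : ℕ) (hd : 2 ≤ d) (a : ℕ → ℝ) (ha0 : ∀ k, 0 ≤ a k) (ha : Summable a)
    (f : ℝ → ℝ) (hf : ContinuousOn f (Set.Icc (-1) 1)) :
    II d (fun t => f t * Kf d a t) = ∑' l, a l * II d (fun t => f t * Geg d l t) := by
  have hc : ∀ l, ContinuousOn (fun t => a l * (f t * Geg d l t)) (Set.Icc (-1) 1) := fun l =>
    continuousOn_const.mul (hf.mul (geg_cont d l).continuousOn)
  have := hasSum_integral_of_summable_integral_norm (μ := volume.restrict (Set.Icc (-1 : ℝ) 1))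
    (F := fun l t => a l * (f t * Geg d l t) * wgt d t) (fun l => II_int d hd _ (hc l)) (by
      refine Summable.of_nonneg_of_le (fun l => integral_nonneg fun t => norm_nonneg _) (fun l => ?_)
        (ha.mul_right (II d fun t => |f t|))
      rw [← II_smul, II]
      refine setIntegral_mono_on (II_int d hd _ (hc l)).norm
        (II_int d hd _ (continuousOn_const.mul hf.abs)) measurableSet_Icc fun t ht => ?_
      rw [norm_mul, Real.norm_of_nonneg (wgt_nonneg d t ht)]
      apply mul_le_mul_of_nonneg_right _ (wgt_nonneg d t ht)
      rw [norm_mul, norm_mul, Real.norm_of_nonneg (ha0 l)]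
      apply mul_le_mul_of_nonneg_left _ (ha0 l)
      exact mul_le_of_le_one_right (norm_nonneg _) (geg_abs_le d hd l t ht))
  have h1 : ∀ l, ∫ t in Set.Icc (-1 : ℝ) 1, a l * (f t * Geg d l t) * wgt d t
      = a l * II d (fun t => f t * Geg d l t) := fun l => II_smul d (a l) _
  simp only [h1] at this
  rw [this.tsum_eq, II]
  refine setIntegral_congr_fun measurableSet_Icc fun t _ => ?_
  simp only [Kf, ← tsum_mul_left, ← tsum_mul_right]
  exact tsum_congr fun l => by ring
lemma hsq_ne (d : ℕ) (hd : 2 ≤ d) (k : ℕ) : II d (fun t => Geg d k t ^ 2) ≠ 0 := by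
  intro h
  have := II_zero d hd _ ((geg_cont d k).pow 2).continuousOn (fun t _ => sq_nonneg _) h 1
    (by norm_num)
  simp [geg_one d hd] at this

lemma wint_ne (d : ℕ) (hd : 2 ≤ d) :
    (∫ t in Set.Icc (-1 : ℝ) 1, ((1 - t ^ 2) ^ (((d : ℝ) - 2) / 2) : ℝ)) ≠ 0 := by
  have h := hsq_ne d hd 0
  simpa [II, Geg, wgt] using h

lemma Ccoef_eq (d : ℕ) (hd : 2 ≤ d) (k l s : ℕ) :
    Ccoef d k l s = II d (fun t => Geg d l t * Geg d s t * Geg d k t)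
      / II d (fun t => Geg d k t ^ 2) := by
  have := inv_ne_zero (wint_ne d hd)
  unfold Ccoef hsqG gInt
  exact mul_div_mul_left _ _ this

lemma gconv_eq (d : ℕ) (hd : 2 ≤ d) (a : ℕ → ℝ) (ha0 : ∀ k, 0 ≤ a k) (ha : Summable a) (k : ℕ) :
    gconv d a a k * II d (fun t => Geg d k t ^ 2)
      = II d (fun t => Kf d a t * Kf d a t * Geg d k t) := by
  have hH := hsq_ne d hd k
  have cK := Kf_cont d hd a ha0 ha
  have cG : ∀ l, ContinuousOn (Geg d l) (Set.Icc (-1) 1) := fun l => (geg_cont d l).continuousOn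
  have e1 : II d (fun t => Kf d a t * Kf d a t * Geg d k t)
      = ∑' l, a l * II d (fun t => (Kf d a t * Geg d k t) * Geg d l t) := by
    rw [← II_Kf d hd a ha0 ha (fun t => Kf d a t * Geg d k t) (cK.mul (cG k))]
    congr 1; funext t; ring
  have e2 : ∀ l, II d (fun t => (Kf d a t * Geg d k t) * Geg d l t)
      = ∑' s, a s * II d (fun t => Geg d l t * Geg d s t * Geg d k t) := by
    intro l
    have : (fun t => (Kf d a t * Geg d k t) * Geg d l t)
        = fun t => (Geg d k t * Geg d l t) * Kf d a t := by funext t; ring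
    rw [this, II_Kf d hd a ha0 ha (fun t => Geg d k t * Geg d l t) ((cG k).mul (cG l))]
    refine tsum_congr fun s => ?_
    congr 2; funext t; ring
  rw [e1]
  unfold gconv
  rw [← tsum_mul_right]
  refine tsum_congr fun l => ?_
  rw [e2, ← tsum_mul_right, ← tsum_mul_left]
  refine tsum_congr fun s => ?_
  rw [Ccoef_eq d hd]
  field_simp

lemma Kf_conv (d : ℕ) (hd : 2 ≤ d) (lam mu nu : ℕ → ℝ)
    (hlam : ∀ k, 0 ≤ lam k) (hmu : ∀ k, 0 ≤ mu k) (hnu : ∀ k, 0 ≤ nu k)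
    (hlsum : Summable lam) (hmsum : Summable mu) (hnsum : Summable nu)
    (hconv : ∀ k, lam k = gconv d mu mu k + gconv d nu nu k) (t : ℝ)
    (ht : t ∈ Set.Icc (-1 : ℝ) 1) :
    Kf d lam t = Kf d mu t * Kf d mu t + Kf d nu t * Kf d nu t := by
  have c1 := Kf_cont d hd lam hlam hlsum
  have c2 := Kf_cont d hd mu hmu hmsum
  have c3 := Kf_cont d hd nu hnu hnsum
  have h := complete d hd
    (fun t => (Kf d mu t * Kf d mu t + Kf d nu t * Kf d nu t) - Kf d lam t)
    (((c2.mul c2).add (c3.mul c3)).sub c1) (by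
      intro k
      have cG : ContinuousOn (Geg d k) (Set.Icc (-1) 1) := (geg_cont d k).continuousOn
      have e : (fun t => ((Kf d mu t * Kf d mu t + Kf d nu t * Kf d nu t) - Kf d lam t) * Geg d k t)
        = fun t => (Kf d mu t * Kf d mu t * Geg d k t + Kf d nu t * Kf d nu t * Geg d k t)
          - Geg d k t * Kf d lam t := by funext t; ring
      rw [e, II_sub d hd (fun t => Kf d mu t * Kf d mu t * Geg d k t
          + Kf d nu t * Kf d nu t * Geg d k t) (fun t => Geg d k t * Kf d lam t)
          (((c2.mul c2).mul cG).add ((c3.mul c3).mul cG)) (cG.mul c1),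
        II_add d hd (fun t => Kf d mu t * Kf d mu t * Geg d k t)
          (fun t => Kf d nu t * Kf d nu t * Geg d k t) ((c2.mul c2).mul cG) ((c3.mul c3).mul cG),
        ← gconv_eq d hd mu hmu hmsum, ← gconv_eq d hd nu hnu hnsum, ← add_mul, ← hconv,
        II_Kf d hd lam hlam hlsum _ cG, tsum_eq_single k]
      · simp only [sq, sub_self]
      · intro l hl
        rw [II_orth d hd k l hl.symm, mul_zero]) t ht
  linarith

/-- Vybiral's inequality for a Gram matrix. -/
lemma vybiral (n : ℕ) (M : Matrix (Fin n) (Fin n) ℝ) (hM : M.PosSemidef) (c : Fin n → ℝ) :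
    (∑ j, c j * M j j) ^ 2 ≤ n * ∑ j, ∑ k, c j * c k * (M j k * M j k) := by
  have hB : ∃ B : Matrix (Fin n) (Fin n) ℝ, M = B.transpose * B := by
    open scoped MatrixOrder Matrix.Norms.L2Operator in
    obtain ⟨B, hB⟩ := CStarAlgebra.nonneg_iff_eq_star_mul_self.mp hM.nonneg
    refine ⟨B, ?_⟩
    rw [hB, Matrix.star_eq_conjTranspose, Matrix.conjTranspose_eq_transpose_of_trivial]
  obtain ⟨B, rfl⟩ := hB
  let T : Fin n → Fin n → ℝ := fun a b => ∑ j, c j * (B a j * B b j)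
  have e1 : ∑ j, c j * (B.transpose * B) j j = ∑ a, T a a := by
    simp only [T, Matrix.mul_apply, Matrix.transpose_apply, Finset.mul_sum]
    rw [Finset.sum_comm]
  have e2 : ∑ j, ∑ k, c j * c k * ((B.transpose * B) j k * (B.transpose * B) j k)
      = ∑ a, ∑ b, T a b ^ 2 := by
    simp only [T, Matrix.mul_apply, Matrix.transpose_apply, sq, Finset.sum_mul_sum]
    simp only [Finset.mul_sum]
    have : ∀ a b : Fin n, ∀ j k : Fin n, c j * (B a j * B b j) * (c k * (B a k * B b k))
      = c j * c k * (B a j * B a k * (B b j * B b k)) := fun a b j k => by ring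
    simp only [this]
    -- move sums: j k a b to a b j k
    calc _ = ∑ j, ∑ a, ∑ k, ∑ b, c j * c k * (B a j * B a k * (B b j * B b k)) :=
          Finset.sum_congr rfl fun j _ => Finset.sum_comm
      _ = ∑ a, ∑ j, ∑ k, ∑ b, c j * c k * (B a j * B a k * (B b j * B b k)) := Finset.sum_comm
      _ = ∑ a, ∑ j, ∑ b, ∑ k, c j * c k * (B a j * B a k * (B b j * B b k)) :=
          Finset.sum_congr rfl fun a _ => Finset.sum_congr rfl fun j _ => Finset.sum_comm
      _ = _ := Finset.sum_congr rfl fun a _ => Finset.sum_comm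
  rw [e1, e2]
  calc (∑ a, T a a) ^ 2 ≤ n * ∑ a, T a a ^ 2 := by
        simpa using sq_sum_le_card_mul_sum_sq (s := (Finset.univ : Finset (Fin n)))
          (f := fun a => T a a)
    _ ≤ n * ∑ a, ∑ b, T a b ^ 2 := by
        gcongr with a
        exact Finset.single_le_sum (f := fun b => T a b ^ 2) (fun b _ => sq_nonneg _)
          (Finset.mem_univ a)

lemma Kf_psd (d : ℕ) (hd : 2 ≤ d) (a : ℕ → ℝ) (ha0 : ∀ k, 0 ≤ a k) (ha : Summable a) (n : ℕ)
    (x : Fin n → Metric.sphere (0 : EuclideanSpace ℝ (Fin (d + 1))) 1)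
    (hx : ∀ j k, ⟪(x j : EuclideanSpace ℝ (Fin (d + 1))), x k⟫ ∈ Set.Icc (-1 : ℝ) 1) :
    (Matrix.of fun j k => Kf d a ⟪(x j : EuclideanSpace ℝ (Fin (d + 1))), x k⟫).PosSemidef := by
  refine Matrix.PosSemidef.of_dotProduct_mulVec_nonneg ?_ ?_
  · ext j k
    simp [real_inner_comm]
  · intro c
    have e : star c ⬝ᵥ (Matrix.of fun j k =>
          Kf d a ⟪(x j : EuclideanSpace ℝ (Fin (d + 1))), x k⟫).mulVec c
        = ∑ j, ∑ k, c j * c k * Kf d a ⟪(x j : EuclideanSpace ℝ (Fin (d + 1))), x k⟫ := by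
      simp only [dotProduct, Matrix.mulVec, Finset.mul_sum, Matrix.of_apply, star_trivial]
      exact Finset.sum_congr rfl fun j _ => Finset.sum_congr rfl fun k _ => by ring
    rw [e]
    have hs : HasSum (fun l => ∑ j, ∑ k, c j * c k *
          (a l * Geg d l ⟪(x j : EuclideanSpace ℝ (Fin (d + 1))), x k⟫))
        (∑ j, ∑ k, c j * c k * Kf d a ⟪(x j : EuclideanSpace ℝ (Fin (d + 1))), x k⟫) :=
      hasSum_sum fun j _ => hasSum_sum fun k _ =>
        (Kf_summable d hd a ha0 ha _ (hx j k)).hasSum.mul_left _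
    refine hs.nonneg fun l => ?_
    have e2 : ∀ j k, ⟪(x j : EuclideanSpace ℝ (Fin (d + 1))), x k⟫
        = ∑ i, (x j : EuclideanSpace ℝ (Fin (d + 1))) i
          * (x k : EuclideanSpace ℝ (Fin (d + 1))) i := by
      intro j k
      rw [PiLp.inner_apply]
      exact Finset.sum_congr rfl fun i _ => by simp [mul_comm]
    have h := geg_psd' d hd l n (fun j i => (x j : EuclideanSpace ℝ (Fin (d + 1))) i) (by
      intro j
      rw [← e2, real_inner_self_eq_norm_sq, norm_eq_of_mem_sphere]; norm_num) c
    have := mul_nonneg (ha0 l) h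
    simp only [e2]
    refine this.trans_eq ?_
    rw [Finset.mul_sum]
    refine Finset.sum_congr rfl fun j _ => ?_
    rw [Finset.mul_sum]
    exact Finset.sum_congr rfl fun k _ => by ring

lemma Kf_one (d : ℕ) (hd : 2 ≤ d) (a : ℕ → ℝ) : Kf d a 1 = ∑' l, a l := by
  simp [Kf, geg_one d hd]

/-- If the nonnegative summable sequence `Λ̃` is a sum of two convolution squares
`Λ̃ = μ̃∗μ̃ + ν̃∗ν̃`, then `e_n(H_Λ̃)² ≥ λ̃₀ (1 − n λ̃₀ / ∑_ℓ λ̃_ℓ)`. -/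
theorem stmt13 (d : ℕ) (hd : 2 ≤ d) (lam mu nu : ℕ → ℝ)
    (hlam : ∀ k, 0 ≤ lam k) (hmu : ∀ k, 0 ≤ mu k) (hnu : ∀ k, 0 ≤ nu k)
    (hlsum : Summable lam) (hmsum : Summable mu) (hnsum : Summable nu)
    (hconv : ∀ k, lam k = gconv d mu mu k + gconv d nu nu k) (n : ℕ) :
    lam 0 * (1 - n * lam 0 / ∑' ℓ : ℕ, lam ℓ) ≤ enSq d n lam := by
  have hne : Nonempty (Metric.sphere (0 : EuclideanSpace ℝ (Fin (d + 1))) 1) :=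
    (NormedSpace.sphere_nonempty.2 zero_le_one).to_subtype
  unfold enSq
  refine le_ciInf fun c => le_ciInf fun x => ?_
  have hx1 : ∀ j, ‖(x j : EuclideanSpace ℝ (Fin (d + 1)))‖ = 1 := fun j => norm_eq_of_mem_sphere _
  have hx : ∀ j k, ⟪(x j : EuclideanSpace ℝ (Fin (d + 1))), x k⟫ ∈ Set.Icc (-1 : ℝ) 1 := by
    intro j k
    have := abs_real_inner_le_norm (x j : EuclideanSpace ℝ (Fin (d + 1))) (x k)
    rw [hx1, hx1, mul_one] at this
    exact abs_le.1 this
  have hxx : ∀ j, ⟪(x j : EuclideanSpace ℝ (Fin (d + 1))), x j⟫ = (1 : ℝ) := by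
    intro j
    rw [real_inner_self_eq_norm_sq, hx1]; norm_num
  have hK := Kf_conv d hd lam mu nu hlam hmu hnu hlsum hmsum hnsum hconv
  set L := ∑' l, lam l with hL
  have hL1 : L = (∑' l, mu l) ^ 2 + (∑' l, nu l) ^ 2 := by
    have := hK 1 (by norm_num)
    rw [Kf_one d hd, Kf_one d hd, Kf_one d hd] at this
    rw [hL, this]; ring
  set S := ∑ j, c j with hS
  set E := ∑ j, ∑ k, c j * c k * sphKernel d lam (x j) (x k) with hE
  have v : ∀ a : ℕ → ℝ, (∀ k, 0 ≤ a k) → Summable a → (S * ∑' l, a l) ^ 2 ≤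
      n * ∑ j, ∑ k, c j * c k * (Kf d a ⟪(x j : EuclideanSpace ℝ (Fin (d + 1))), x k⟫
        * Kf d a ⟪(x j : EuclideanSpace ℝ (Fin (d + 1))), x k⟫) := by
    intro a ha0 ha
    have := vybiral n _ (Kf_psd d hd a ha0 ha n x hx) c
    simp only [Matrix.of_apply, hxx, Kf_one d hd, ← Finset.sum_mul] at this
    exact this
  have hEe : E = (∑ j, ∑ k, c j * c k * (Kf d mu ⟪(x j : EuclideanSpace ℝ (Fin (d + 1))), x k⟫
        * Kf d mu ⟪(x j : EuclideanSpace ℝ (Fin (d + 1))), x k⟫))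
      + ∑ j, ∑ k, c j * c k * (Kf d nu ⟪(x j : EuclideanSpace ℝ (Fin (d + 1))), x k⟫
        * Kf d nu ⟪(x j : EuclideanSpace ℝ (Fin (d + 1))), x k⟫) := by
    rw [hE, ← Finset.sum_add_distrib]
    refine Finset.sum_congr rfl fun j _ => ?_
    rw [← Finset.sum_add_distrib]
    refine Finset.sum_congr rfl fun k _ => ?_
    have : sphKernel d lam (x j) (x k)
        = Kf d lam ⟪(x j : EuclideanSpace ℝ (Fin (d + 1))), x k⟫ := rfl
    rw [this, hK _ (hx j k)]; ring
  have key : L * S ^ 2 ≤ n * E := by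
    have h1 := v mu hmu hmsum
    have h2 := v nu hnu hnsum
    rw [hEe, hL1, mul_add (n : ℝ)]
    nlinarith
  have hl0 : lam 0 ≤ L := hlsum.le_tsum 0 fun k _ => hlam k
  have hLn : 0 ≤ L := (hlam 0).trans hl0
  rcases Nat.eq_zero_or_pos n with hn | hn
  · subst hn
    simp [hS, hE]
  have hn' : (0 : ℝ) < n := by exact_mod_cast hn
  rcases hLn.eq_or_lt with h0 | hpos
  · have hz : lam 0 = 0 := le_antisymm (by linarith) (hlam 0)
    have : 0 ≤ E := by
      rw [← h0, zero_mul] at key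
      exact nonneg_of_mul_nonneg_right key hn'
    simp only [hz]
    linarith
  · have hgoal : 0 ≤ (n * L) * ((lam 0 - 2 * lam 0 * S + E) - lam 0 * (1 - n * lam 0 / L)) := by
      have : (n * L) * ((lam 0 - 2 * lam 0 * S + E) - lam 0 * (1 - n * lam 0 / L))
          = L * (n * E - L * S ^ 2) + (L * S - n * lam 0) ^ 2 := by
        field_simp
        ring
      rw [this]
      have := mul_nonneg hLn (sub_nonneg.2 key)
      positivity
    have := nonneg_of_mul_nonneg_right hgoal (by positivity)
    linarith
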